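/- Let (V,E) be a finite digraph and let V₁ ⊆ V be such that there is no edge from outside V₁ into V₁. Let (s_i, t_i), i ∈ {1,…,h}, be terminal pairs and suppose the index set partitions as A = {i : s_i ∈ V₁ and t_i ∈ V₁}, B = {i : s_i ∉ V₁ and t_i ∉ V₁}, and T = {i : s_i ∈ V₁ and t_i ∉ V₁} (no pair has s_i ∉ V₁ and t_i ∈ V₁). Then there exist pairwise vertex-disjoint paths P_1,…,P_h with each P_i a shortest path from s_i to t_i, if and only if there exists an assignment to each i ∈ T of an edge (u_i, w_i) with u_i ∈ V₁ and w_i ∉ V₁, together with a family of pairwise vertex-disjoint paths all of whose vertices lie in V₁, consisting of a shortest s_i–t_i path for every i ∈ A and a shortest s_i–u_i path for every i ∈ T, and a family of pairwise vertex-disjoint paths all of whose vertices lie outside V₁, consisting of a shortest s_i–t_i path for every i ∈ B and a shortest w_i–t_i path for every i ∈ T, such that for every i ∈ T, dist(s_i,u_i) + 1 + dist(w_i,t_i) = dist(s_i,t_i). -/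

import Mathlib

/-- A walk from `s` to `t` in the digraph `(V, E)`: a nonempty list of vertices starting
at `s`, ending at `t`, with `E` holding between consecutive vertices. -/
def IsWalk {V : Type*} (E : V → V → Prop) (s t : V) (W : List V) : Prop :=
  W ≠ [] ∧ W.head? = some s ∧ W.getLast? = some t ∧ W.Chain' E

/-- The length of a walk: the number of consecutive pairs (edges). -/
def walkLength {V : Type*} (W : List V) : ℕ := W.length - 1

/-- A path: a walk with pairwise distinct vertices. -/
def IsPath {V : Type*} (E : V → V → Prop) (s t : V) (W : List V) : Prop :=
  IsWalk E s t W ∧ W.Nodup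

/-- Acyclicity: no walk of positive length starts and ends at the same vertex. -/
def IsAcyclic {V : Type*} (E : V → V → Prop) : Prop :=
  ∀ (v : V) (W : List V), IsWalk E v v W → walkLength W = 0

/-- The distance from `s` to `t`: the minimum length of a walk from `s` to `t`. -/
noncomputable def walkDist {V : Type*} (E : V → V → Prop) (s t : V) : ℕ :=
  sInf {n | ∃ W, IsWalk E s t W ∧ walkLength W = n}

/-- A shortest path from `s` to `t`: a path from `s` to `t` of length `walkDist E s t`. -/
def IsShortestPath {V : Type*} (E : V → V → Prop) (s t : V) (W : List V) : Prop :=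
  IsPath E s t W ∧ walkLength W = walkDist E s t

/-- The congestion of a vertex `v` with respect to a family of walks:
the number of members of the family containing `v`. -/
noncomputable def congestion {V : Type*} {ι : Type*} (P : ι → List V) (v : V) : ℕ :=
  Nat.card {i : ι // v ∈ P i}

theorem isWalk_singleton {V : Type*} {E : V → V → Prop} {s t a : V} :
    IsWalk E s t [a] ↔ a = s ∧ a = t := by
  simp [IsWalk, List.Chain']

theorem isWalk_cons_cons {V : Type*} {E : V → V → Prop} {s t a b : V} {l : List V} :
    IsWalk E s t (a :: b :: l) ↔ a = s ∧ E a b ∧ IsWalk E b t (b :: l) := by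
  simp only [IsWalk, List.Chain', List.isChain_cons_cons, List.getLast?_cons_cons, List.head?_cons,
    Option.some.injEq, ne_eq, reduceCtorEq, not_false_eq_true, true_and]
  tauto

theorem IsWalk.append {V : Type*} {E : V → V → Prop} {s u w t : V} {Q R : List V}
    (hQ : IsWalk E s u Q) (huw : E u w) (hR : IsWalk E w t R) : IsWalk E s t (Q ++ R) := by
  obtain ⟨hQ₀, hQs, hQu, hQc⟩ := hQ
  obtain ⟨hR₀, hRw, hRt, hRc⟩ := hR
  refine ⟨by simp [hQ₀], ?_, ?_, List.IsChain.append hQc hRc ?_⟩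
  · simp [List.head?_append, hQs]
  · simp [List.getLast?_append, hRt]
  · intro x hx y hy
    simp_all

theorem walkLength_append {V : Type*} {Q R : List V} (hQ : Q ≠ []) (hR : R ≠ []) :
    walkLength (Q ++ R) = walkLength Q + 1 + walkLength R := by
  have := List.length_pos_iff.2 hQ
  have := List.length_pos_iff.2 hR
  simp only [walkLength, List.length_append]
  omega

theorem IsWalk.walkDist_le {V : Type*} {E : V → V → Prop} {s t : V} {W : List V}
    (hW : IsWalk E s t W) : walkDist E s t ≤ walkLength W :=
  Nat.sInf_le ⟨W, hW, rfl⟩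

theorem IsWalk.exists_walkLength_eq_walkDist {V : Type*} {E : V → V → Prop} {s t : V}
    {W : List V} (hW : IsWalk E s t W) :
    ∃ W', IsWalk E s t W' ∧ walkLength W' = walkDist E s t :=
  Nat.sInf_mem (s := {n | ∃ W, IsWalk E s t W ∧ walkLength W = n}) ⟨_, W, hW, rfl⟩

/-- A walk starting outside `V₁` stays outside `V₁`. -/
theorem IsWalk.forall_notMem {V : Type*} {E : V → V → Prop} {V₁ : Set V}
    (hcl : ∀ u ∉ V₁, ∀ v ∈ V₁, ¬ E u v) {s t : V} {W : List V} (hW : IsWalk E s t W)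
    (hs : s ∉ V₁) : ∀ v ∈ W, v ∉ V₁ := by
  induction W generalizing s with
  | nil => simp
  | cons a l ih =>
    cases l with
    | nil =>
      obtain ⟨rfl, -⟩ := isWalk_singleton.1 hW
      simpa using hs
    | cons b l =>
      obtain ⟨rfl, hab, hb⟩ := isWalk_cons_cons.1 hW
      exact List.forall_mem_cons.2 ⟨hs, ih hb fun h => hcl _ hs _ h hab⟩

/-- A walk ending inside `V₁` stays inside `V₁`. -/
theorem IsWalk.forall_mem {V : Type*} {E : V → V → Prop} {V₁ : Set V}
    (hcl : ∀ u ∉ V₁, ∀ v ∈ V₁, ¬ E u v) {s t : V} {W : List V} (hW : IsWalk E s t W)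
    (ht : t ∈ V₁) : ∀ v ∈ W, v ∈ V₁ := by
  induction W generalizing s with
  | nil => simp
  | cons a l ih =>
    cases l with
    | nil =>
      obtain ⟨-, rfl⟩ := isWalk_singleton.1 hW
      simpa using ht
    | cons b l =>
      obtain ⟨rfl, hab, hb⟩ := isWalk_cons_cons.1 hW
      have hl := ih hb
      refine List.forall_mem_cons.2 ⟨?_, hl⟩
      by_contra ha
      exact hcl _ ha _ (hl b (by simp)) hab

/-- A walk leaving `V₁` splits at the edge through which it leaves. -/
theorem IsWalk.exists_eq_append {V : Type*} {E : V → V → Prop} {V₁ : Set V}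
    {s t : V} {W : List V} (hW : IsWalk E s t W) (hs : s ∈ V₁) (ht : t ∉ V₁) :
    ∃ u w Q R, W = Q ++ R ∧ u ∈ V₁ ∧ w ∉ V₁ ∧ E u w ∧ IsWalk E s u Q ∧ IsWalk E w t R := by
  induction W generalizing s with
  | nil => exact absurd rfl hW.1
  | cons a l ih =>
    cases l with
    | nil =>
      obtain ⟨rfl, rfl⟩ := isWalk_singleton.1 hW
      exact absurd hs ht
    | cons b l =>
      obtain ⟨rfl, hab, hb⟩ := isWalk_cons_cons.1 hW
      by_cases hbV : b ∈ V₁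
      · obtain ⟨u, w, Q, R, hl, hu, hw, huw, hQ, hR⟩ := ih hb hbV
        refine ⟨u, w, a :: Q, R, by simp [hl], hu, hw, huw, ?_, hR⟩
        exact IsWalk.append (isWalk_singleton.2 ⟨rfl, rfl⟩) hab hQ
      · exact ⟨a, b, [a], b :: l, rfl, hs, hbV, hab, isWalk_singleton.2 ⟨rfl, rfl⟩, hb⟩

/-- If a shortest path splits at an edge, both parts are shortest paths and the distances add. -/
theorem IsShortestPath.of_append {V : Type*} {E : V → V → Prop} {s u w t : V} {Q R : List V}
    (hP : IsShortestPath E s t (Q ++ R)) (hQ : IsWalk E s u Q) (huw : E u w)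
    (hR : IsWalk E w t R) :
    IsShortestPath E s u Q ∧ IsShortestPath E w t R ∧
      walkDist E s u + 1 + walkDist E w t = walkDist E s t := by
  obtain ⟨Q', hQ', hQl⟩ := hQ.exists_walkLength_eq_walkDist
  obtain ⟨R', hR', hRl⟩ := hR.exists_walkLength_eq_walkDist
  have hle := (hQ'.append huw hR').walkDist_le
  have hlen := hP.2
  rw [walkLength_append hQ'.1 hR'.1] at hle
  rw [walkLength_append hQ.1 hR.1] at hlen
  have hQd := hQ.walkDist_le
  have hRd := hR.walkDist_le
  have hnd := List.nodup_append.1 hP.1.2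
  exact ⟨⟨⟨hQ, hnd.1⟩, by omega⟩, ⟨⟨hR, hnd.2.1⟩, by omega⟩, by omega⟩

/-- Disjoint shortest paths joined by an edge form a shortest path if the distances add. -/
theorem IsShortestPath.append {V : Type*} {E : V → V → Prop} {s u w t : V} {Q R : List V}
    (hQ : IsShortestPath E s u Q) (huw : E u w) (hR : IsShortestPath E w t R)
    (hd : walkDist E s u + 1 + walkDist E w t = walkDist E s t) (hQR : Q.Disjoint R) :
    IsShortestPath E s t (Q ++ R) :=
  ⟨⟨hQ.1.1.append huw hR.1.1, hQ.1.2.append hR.1.2 hQR⟩, by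
    rw [walkLength_append hQ.1.1.1 hR.1.1.1, hQ.2, hR.2, hd]⟩

/-- The divide-and-conquer merge step: if there is no edge from outside `V₁` into `V₁`,
then vertex-disjoint shortest paths for the terminal pairs exist iff one can choose, for
every crossing pair (`s i ∈ V₁`, `t i ∉ V₁`), a boundary edge `(u i, w i)` splitting the
distance, together with a vertex-disjoint family of shortest paths inside `V₁` (for pairs
inside `V₁` and for the prefixes `s i – u i`) and a vertex-disjoint family of shortest
paths outside `V₁` (for pairs outside `V₁` and for the suffixes `w i – t i`). -/
theorem merge_step {V : Type*} [Fintype V] (E : V → V → Prop) (V₁ : Set V)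
    (hcl : ∀ u ∉ V₁, ∀ v ∈ V₁, ¬ E u v)
    (h : ℕ) (s t : Fin h → V)
    (hno : ∀ i, ¬ (s i ∉ V₁ ∧ t i ∈ V₁)) :
    (∃ P : Fin h → List V,
        (∀ i, IsShortestPath E (s i) (t i) (P i)) ∧
        ∀ i j, i ≠ j → ∀ v, ¬ (v ∈ P i ∧ v ∈ P j)) ↔
      (∃ u w : Fin h → V, ∃ Q R : Fin h → List V,
        (∀ i, s i ∈ V₁ → t i ∉ V₁ →
          u i ∈ V₁ ∧ w i ∉ V₁ ∧ E (u i) (w i) ∧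
            walkDist E (s i) (u i) + 1 + walkDist E (w i) (t i) =
              walkDist E (s i) (t i)) ∧
        (∀ i, s i ∈ V₁ → t i ∈ V₁ → IsShortestPath E (s i) (t i) (Q i)) ∧
        (∀ i, s i ∈ V₁ → t i ∉ V₁ → IsShortestPath E (s i) (u i) (Q i)) ∧
        (∀ i, s i ∈ V₁ → ∀ v ∈ Q i, v ∈ V₁) ∧
        (∀ i j, i ≠ j → s i ∈ V₁ → s j ∈ V₁ → ∀ v, ¬ (v ∈ Q i ∧ v ∈ Q j)) ∧
        (∀ i, s i ∉ V₁ → t i ∉ V₁ → IsShortestPath E (s i) (t i) (R i)) ∧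
        (∀ i, s i ∈ V₁ → t i ∉ V₁ → IsShortestPath E (w i) (t i) (R i)) ∧
        (∀ i, t i ∉ V₁ → ∀ v ∈ R i, v ∉ V₁) ∧
        (∀ i j, i ≠ j → t i ∉ V₁ → t j ∉ V₁ → ∀ v, ¬ (v ∈ R i ∧ v ∈ R j))) := by
  constructor
  · rintro ⟨P, hP, hdisj⟩
    have hsplit : ∀ i, ∃ u w : V, ∃ Q R : List V, Q ⊆ P i ∧ R ⊆ P i ∧
        (s i ∈ V₁ → t i ∉ V₁ →
          (u ∈ V₁ ∧ w ∉ V₁ ∧ E u w ∧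
            walkDist E (s i) u + 1 + walkDist E w (t i) = walkDist E (s i) (t i)) ∧
          IsShortestPath E (s i) u Q ∧ IsShortestPath E w (t i) R) ∧
        (s i ∈ V₁ → t i ∈ V₁ → IsShortestPath E (s i) (t i) Q) ∧
        (s i ∉ V₁ → t i ∉ V₁ → IsShortestPath E (s i) (t i) R) := by
      intro i
      by_cases hst : s i ∈ V₁ ∧ t i ∉ V₁
      · obtain ⟨hs, ht⟩ := hst
        obtain ⟨u, w, Q, R, hPi, hu, hw, huw, hQ, hR⟩ := (hP i).1.1.exists_eq_append hs ht
        have hPi' := hP i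
        rw [hPi] at hPi'
        obtain ⟨hQ', hR', hd⟩ := hPi'.of_append hQ huw hR
        exact ⟨u, w, Q, R, by simp [hPi], by simp [hPi],
          fun _ _ => ⟨⟨hu, hw, huw, hd⟩, hQ', hR'⟩, fun _ h => absurd h ht, fun h => absurd hs h⟩
      · exact ⟨s i, s i, P i, P i, List.Subset.refl _, List.Subset.refl _,
          fun hs ht => absurd ⟨hs, ht⟩ hst, fun _ _ => hP i, fun _ _ => hP i⟩
    choose u w Q R hQP hRP hT hA hB using hsplit
    refine ⟨u, w, Q, R, fun i hs ht => (hT i hs ht).1, hA, fun i hs ht => (hT i hs ht).2.1, ?_,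
      fun i j hij _ _ v hv => hdisj i j hij v ⟨hQP i hv.1, hQP j hv.2⟩, hB,
      fun i hs ht => (hT i hs ht).2.2, ?_,
      fun i j hij _ _ v hv => hdisj i j hij v ⟨hRP i hv.1, hRP j hv.2⟩⟩
    · intro i hs
      by_cases ht : t i ∈ V₁
      · exact (hA i hs ht).1.1.forall_mem hcl ht
      · exact (hT i hs ht).2.1.1.1.forall_mem hcl (hT i hs ht).1.1
    · intro i ht
      by_cases hs : s i ∈ V₁
      · exact (hT i hs ht).2.2.1.1.forall_notMem hcl (hT i hs ht).1.2.1
      · exact (hB i hs ht).1.1.forall_notMem hcl hs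
  · rintro ⟨u, w, Q, R, hT, hA, hTQ, hQV, hQd, hB, hTR, hRV, hRd⟩
    have hjoin : ∀ i, ∃ P, IsShortestPath E (s i) (t i) P ∧
        ∀ v ∈ P, (s i ∈ V₁ ∧ v ∈ Q i) ∨ (t i ∉ V₁ ∧ v ∈ R i) := by
      intro i
      by_cases hs : s i ∈ V₁ <;> by_cases ht : t i ∈ V₁
      · exact ⟨Q i, hA i hs ht, fun v hv => Or.inl ⟨hs, hv⟩⟩
      · obtain ⟨-, -, huw, hd⟩ := hT i hs ht
        refine ⟨Q i ++ R i, (hTQ i hs ht).append huw (hTR i hs ht) hd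
          fun v hQ hR => hRV i ht v hR (hQV i hs v hQ), fun v hv => ?_⟩
        exact (List.mem_append.1 hv).imp (⟨hs, ·⟩) (⟨ht, ·⟩)
      · exact absurd ⟨hs, ht⟩ (hno i)
      · exact ⟨R i, hB i hs ht, fun v hv => Or.inr ⟨ht, hv⟩⟩
    choose P hP hPQR using hjoin
    refine ⟨P, hP, fun i j hij v hv => ?_⟩
    rcases hPQR i v hv.1 with ⟨hi, hvi⟩ | ⟨hi, hvi⟩ <;>
      rcases hPQR j v hv.2 with ⟨hj, hvj⟩ | ⟨hj, hvj⟩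
    · exact hQd i j hij hi hj v ⟨hvi, hvj⟩
    · exact hRV j hj v hvj (hQV i hi v hvi)
    · exact hRV i hi v hvi (hQV j hj v hvj)
    · exact hRd i j hij hi hj v ⟨hvi, hvj⟩
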